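/- Let φ : ℝ → ℂ be Lipschitz continuous with constant ‖φ‖_Lip, let M₁, M₂ be n×n Hermitian matrices, and let p ≥ 1. Then |Tr φ(M₁) − Tr φ(M₂)|^p ≤ ‖φ‖_Lip^p · n^{p−1} · ‖M₁ − M₂‖_{S^p}^p, where ‖A‖_{S^p} is the Schatten p-norm. -/

import Mathlib

open Matrix

theorem weyl_mono {E : Type*} [NormedAddCommGroup E] [InnerProductSpace ℂ E]
    [FiniteDimensional ℂ E] {n : ℕ} (hn : Module.finrank ℂ E = n) {T S : E →ₗ[ℂ] E}
    (hT : T.IsSymmetric) (hS : S.IsSymmetric)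
    (h : ∀ x, RCLike.re (inner ℂ x (T x)) ≤ RCLike.re (inner ℂ x (S x))) (i : Fin n) :
    hT.eigenvalues hn i ≤ hS.eigenvalues hn i := by
  have key : ∀ {R : E →ₗ[ℂ] E} (hR : R.IsSymmetric) (x : E),
      RCLike.re (inner ℂ x (R x)) =
        ∑ j, hR.eigenvalues hn j * ‖inner ℂ (hR.eigenvectorBasis hn j) x‖ ^ 2 := by
    intro R hR x
    rw [← (hR.eigenvectorBasis hn).sum_inner_mul_inner x (R x), map_sum]
    refine Finset.sum_congr rfl fun j _ => ?_
    have h1 := hR.eigenvectorBasis_apply_self_apply hn x j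
    rw [OrthonormalBasis.repr_apply_apply, OrthonormalBasis.repr_apply_apply] at h1
    rw [h1, ← inner_conj_symm x]
    rw [mul_left_comm, RCLike.conj_mul]
    norm_cast
  let f : E →ₗ[ℂ] ({j : Fin n // j ≠ i} → ℂ) := LinearMap.pi fun j =>
    if i < j.1 then (innerSL ℂ (hT.eigenvectorBasis hn j)).toLinearMap
    else (innerSL ℂ (hS.eigenvectorBasis hn j)).toLinearMap
  have hf : LinearMap.ker f ≠ ⊥ := by
    apply LinearMap.ker_ne_bot_of_finrank_lt
    have := i.2
    simp [hn]
    omega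
  obtain ⟨x, hx, hx0⟩ := Submodule.exists_mem_ne_zero_of_ne_bot hf
  have hx1 : ∀ j, i < j → inner ℂ (hT.eigenvectorBasis hn j) x = 0 := by
    intro j hj
    have := congrFun (LinearMap.mem_ker.1 hx) ⟨j, hj.ne'⟩
    simpa [f, hj] using this
  have hx2 : ∀ j, j < i → inner ℂ (hS.eigenvectorBasis hn j) x = 0 := by
    intro j hj
    have := congrFun (LinearMap.mem_ker.1 hx) ⟨j, hj.ne⟩
    simpa [f, hj.not_gt] using this
  have e1 : hT.eigenvalues hn i * ‖x‖ ^ 2 ≤ RCLike.re (inner ℂ x (T x)) := by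
    rw [key hT, ← (hT.eigenvectorBasis hn).sum_sq_norm_inner_right, Finset.mul_sum]
    refine Finset.sum_le_sum fun j _ => ?_
    rcases le_or_gt j i with hj | hj
    · exact mul_le_mul_of_nonneg_right (hT.eigenvalues_antitone hn hj) (by positivity)
    · simp [hx1 j hj]
  have e2 : RCLike.re (inner ℂ x (S x)) ≤ hS.eigenvalues hn i * ‖x‖ ^ 2 := by
    rw [key hS, ← (hS.eigenvectorBasis hn).sum_sq_norm_inner_right, Finset.mul_sum]
    refine Finset.sum_le_sum fun j _ => ?_
    rcases le_or_gt i j with hj | hj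
    · exact mul_le_mul_of_nonneg_right (hS.eigenvalues_antitone hn hj) (by positivity)
    · simp [hx2 j hj]
  have hpos : 0 < ‖x‖ ^ 2 := by positivity
  exact le_of_mul_le_mul_right (e1.trans ((h x).trans e2)) hpos

open scoped ComplexOrder in
theorem weyl_mono_matrix {n : ℕ} {A D : Matrix (Fin n) (Fin n) ℂ} (hA : A.IsHermitian)
    (hD : D.IsHermitian) (h : (D - A).PosSemidef) (i : Fin n) :
    hA.eigenvalues i ≤ hD.eigenvalues i := by
  unfold Matrix.IsHermitian.eigenvalues Matrix.IsHermitian.eigenvalues₀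
  apply weyl_mono
  intro x
  have := (Matrix.isPositive_toEuclideanLin_iff.2 h).re_inner_nonneg_right x
  simpa [inner_sub_right] using this

open scoped ComplexOrder in
theorem trace_norm_bound {n : ℕ} {A B : Matrix (Fin n) (Fin n) ℂ} (hA : A.IsHermitian)
    (hB : B.IsHermitian) (hC : (A - B).IsHermitian) :
    ∑ i, |hA.eigenvalues i - hB.eigenvalues i| ≤ ∑ i, |hC.eigenvalues i| := by
  let U : Matrix (Fin n) (Fin n) ℂ := hC.eigenvectorUnitary
  let c := hC.eigenvalues
  have hU : Uᴴ * U = 1 := Unitary.coe_star_mul_self hC.eigenvectorUnitary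
  have hCU : A - B = U * diagonal (fun i => ((c i : ℝ) : ℂ)) * Uᴴ := by
    have := hC.spectral_theorem
    rw [Unitary.conjStarAlgAut_apply] at this
    exact this
  let P : Matrix (Fin n) (Fin n) ℂ := U * diagonal (fun i => ((max (c i) 0 : ℝ) : ℂ)) * Uᴴ
  have hP : P.PosSemidef := by
    refine Matrix.PosSemidef.mul_mul_conjTranspose_same (Matrix.PosSemidef.diagonal ?_) U
    intro i
    simp only [Pi.zero_apply, Complex.zero_le_real]
    exact le_max_right _ _
  have hQ : (B + P - A).PosSemidef := by
    have : B + P - A = U * diagonal (fun i => ((max (c i) 0 - c i : ℝ) : ℂ)) * Uᴴ := by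
      have e : B + P - A = P - (A - B) := by abel
      rw [e, hCU, ← sub_mul, ← mul_sub, diagonal_sub]
      simp
    rw [this]
    refine Matrix.PosSemidef.mul_mul_conjTranspose_same (Matrix.PosSemidef.diagonal ?_) U
    intro i
    simp only [Pi.zero_apply, Complex.zero_le_real, sub_nonneg]
    exact le_max_left _ _
  have hD : (B + P).IsHermitian := hB.add hP.1
  have m1 := fun i => weyl_mono_matrix hA hD hQ i
  have m2 := fun i => weyl_mono_matrix hB hD (by simpa using hP) i
  have tA : (A.trace).re = ∑ i, hA.eigenvalues i := by rw [hA.trace_eq_sum_eigenvalues]; simp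
  have tB : (B.trace).re = ∑ i, hB.eigenvalues i := by rw [hB.trace_eq_sum_eigenvalues]; simp
  have tC : (A.trace).re - (B.trace).re = ∑ i, hC.eigenvalues i := by
    have : ((A - B).trace).re = ∑ i, hC.eigenvalues i := by
      rw [hC.trace_eq_sum_eigenvalues]; simp
    simpa [Matrix.trace_sub] using this
  have tP : (P.trace).re = ∑ i, max (c i) 0 := by
    simp only [P]
    rw [Matrix.trace_mul_cycle, hU, one_mul, Matrix.trace_diagonal]
    simp
  have tD : (B.trace).re + (P.trace).re = ∑ i, hD.eigenvalues i := by
    have : ((B + P).trace).re = ∑ i, hD.eigenvalues i := by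
      rw [hD.trace_eq_sum_eigenvalues]; simp
    simpa [Matrix.trace_add] using this
  calc ∑ i, |hA.eigenvalues i - hB.eigenvalues i|
      ≤ ∑ i, (2 * hD.eigenvalues i - hA.eigenvalues i - hB.eigenvalues i) := by
        refine Finset.sum_le_sum fun i _ => ?_
        rw [abs_le]
        constructor <;> linarith [m1 i, m2 i]
    _ = ∑ i, (2 * max (c i) 0 - c i) := by
        simp only [Finset.sum_sub_distrib, ← Finset.mul_sum]
        linarith
    _ = ∑ i, |hC.eigenvalues i| := by
        refine Finset.sum_congr rfl fun i _ => ?_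
        change 2 * max (c i) 0 - c i = |c i|
        rcases le_total (c i) 0 with h | h
        · rw [max_eq_right h, abs_of_nonpos h]; ring
        · rw [max_eq_left h, abs_of_nonneg h]; ring


/-- Trace-Lipschitz bound: for Lipschitz `φ : ℝ → ℂ`, Hermitian `M₁, M₂` and `p ≥ 1`,
`|Tr φ(M₁) − Tr φ(M₂)|^p ≤ ‖φ‖_Lip^p n^{p−1} ‖M₁ − M₂‖_{S^p}^p`, where traces of
`φ(Mᵢ)` are sums of `φ` over eigenvalues and the Schatten `p`-norm (to the `p`) of the
Hermitian matrix `M₁ − M₂` is the sum of the `p`-th powers of the moduli of its eigenvalues. -/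
theorem trace_lipschitz_schatten (n : ℕ) (φ : ℝ → ℂ) (K : NNReal) (hφ : LipschitzWith K φ)
    (M₁ M₂ : Matrix (Fin n) (Fin n) ℂ) (h₁ : M₁.IsHermitian) (h₂ : M₂.IsHermitian)
    (h₁₂ : (M₁ - M₂).IsHermitian) (p : ℝ) (hp : 1 ≤ p) :
    ‖(∑ i, φ (h₁.eigenvalues i)) - ∑ i, φ (h₂.eigenvalues i)‖ ^ p
      ≤ (K : ℝ) ^ p * (n : ℝ) ^ (p - 1) * ∑ i, |h₁₂.eigenvalues i| ^ p := by
  have h0 : ‖(∑ i, φ (h₁.eigenvalues i)) - ∑ i, φ (h₂.eigenvalues i)‖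
      ≤ K * ∑ i, |h₁₂.eigenvalues i| := by
    rw [← Finset.sum_sub_distrib]
    refine (norm_sum_le _ _).trans ?_
    refine le_trans ?_ (mul_le_mul_of_nonneg_left (trace_norm_bound h₁ h₂ h₁₂) K.2)
    rw [Finset.mul_sum]
    refine Finset.sum_le_sum fun i _ => ?_
    simpa [dist_eq_norm, Real.norm_eq_abs] using
      hφ.dist_le_mul (h₁.eigenvalues i) (h₂.eigenvalues i)
  have h3 := Real.rpow_sum_le_const_mul_sum_rpow Finset.univ h₁₂.eigenvalues hp
  rw [Finset.card_univ, Fintype.card_fin] at h3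
  calc _ ≤ ((K : ℝ) * ∑ i, |h₁₂.eigenvalues i|) ^ p :=
        Real.rpow_le_rpow (norm_nonneg _) h0 (by linarith)
    _ = (K : ℝ) ^ p * (∑ i, |h₁₂.eigenvalues i|) ^ p :=
        Real.mul_rpow K.2 (Finset.sum_nonneg fun i _ => abs_nonneg _)
    _ ≤ _ := by
        rw [mul_assoc]
        exact mul_le_mul_of_nonneg_left h3 (Real.rpow_nonneg K.2 _)
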